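/- Assume in addition that a is not a.e. zero on any right neighborhood of τ_i and on any left neighborhood of σ_{i+1}, i.e. ∫_{τ_i}^{t} a⁻ > 0 for every t ∈ (τ_i, σ_{i+1}] and ∫_{t}^{σ_{i+1}} a⁻ > 0 for every t ∈ [τ_i, σ_{i+1}), for i = 1,…,m. Let λ > 0 and 0 < r < R. Then for every ε with 0 < ε ≤ r there exists μ★★_ε > 0 such that for every μ > μ★★_ε the following holds: every non-negative solution w of u'' + (λa⁺(t) − μa⁻(t)) g(u) = 0 on all of ℝ with sup_{t∈ℝ} w(t) ≤ R satisfies max_{t∈I⁻_{i,ℓ}} w(t) < ε for every i ∈ {1,…,m} and ℓ ∈ ℤ, where I⁻_{i,ℓ} := I⁻_i + ℓT. -/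

import Mathlib

open MeasureTheory Set Filter Topology

/-- A Carathéodory solution of `u'' + q(t) G(u) = 0` on all of `ℝ`:
`u` is `C¹` with derivative `v`, and `v t = v t₀ - ∫_{t₀}^{t} q s * G (u s) ds`. -/
def IsSolR (q G u v : ℝ → ℝ) : Prop :=
  (∀ t, HasDerivAt u (v t) t) ∧
    ∀ t₀ t : ℝ, v t = v t₀ - ∫ s in t₀..t, q s * G (u s)

/-- The coefficient times `g ∘ u` is interval integrable for a non-negative continuous `u`. -/
theorem intervalIntegrable_weight_mul_comp {g b u : ℝ → ℝ} (hg : ContinuousOn g (Ici 0))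
    (hb : ∀ x y, IntervalIntegrable b volume x y) (hu : Continuous u) (hu0 : ∀ t, 0 ≤ u t)
    (x y : ℝ) : IntervalIntegrable (fun s => b s * g (u s)) volume x y := by
  have hc : Continuous fun s => g (u s) := hg.comp_continuous hu hu0
  exact (hb x y).mul_continuousOn hc.continuousOn

/-- The positive part of a locally integrable weight is interval integrable. -/
theorem intervalIntegrable_max_zero {b : ℝ → ℝ}
    (hb : ∀ x y, IntervalIntegrable b volume x y) (x y : ℝ) :
    IntervalIntegrable (fun s => max (b s) 0) volume x y :=
  ⟨(hb x y).1.pos_part, (hb x y).2.pos_part⟩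

/-- On an interval where the weight is non-positive, the derivative of a non-negative solution
increases at least by the contribution of a lower bound for `g ∘ w`. -/
theorem IsSolR.add_le_of_nonpos {g a w v : ℝ → ℝ} {lam mu γ s t : ℝ}
    (hg : ContinuousOn g (Ici 0)) (ha : ∀ x y, IntervalIntegrable a volume x y)
    (hmu : 0 ≤ mu) (hst : s ≤ t)
    (hneg : ∀ᵐ x : ℝ ∂volume, x ∈ Icc s t → a x ≤ 0)
    (hsol : IsSolR (fun t => lam * max (a t) 0 - mu * max (-a t) 0) g w v)
    (hw0 : ∀ t, 0 ≤ w t) (hγ : ∀ x ∈ Icc s t, γ ≤ g (w x)) :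
    v s + mu * γ * ∫ x in s..t, max (-a x) 0 ≤ v t := by
  have hw : Continuous w := continuous_iff_continuousAt.2 fun t => (hsol.1 t).continuousAt
  have hap := intervalIntegrable_max_zero ha
  have han := intervalIntegrable_max_zero (b := fun x => -a x) fun x y => (ha x y).neg
  have hq := fun x y => ((hap x y).const_mul lam).sub ((han x y).const_mul mu)
  have hint : ∫ x in s..t, (lam * max (a x) 0 - mu * max (-a x) 0) * g (w x) ≤
      ∫ x in s..t, -(mu * γ) * max (-a x) 0 := by
    refine intervalIntegral.integral_mono_ae_restrict hst
      (intervalIntegrable_weight_mul_comp hg hq hw hw0 s t) ((han s t).const_mul _) ?_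
    refine (ae_restrict_iff' measurableSet_Icc).2 ?_
    filter_upwards [hneg] with x hx hxm
    have h1 := hx hxm
    have h2 : max (a x) 0 = 0 := max_eq_right h1
    have h3 := mul_le_mul_of_nonneg_left (hγ x hxm)
      (mul_nonneg hmu (le_max_right (-a x) 0))
    simp only [h2]
    linarith
  rw [intervalIntegral.integral_const_mul] at hint
  have := hsol.2 s t
  linarith

/-- On an interval where the weight is non-negative, the derivative of a non-negative solution
decreases at most by `lam * G * ∫ a⁺`, where `G` bounds `g ∘ w`. -/
theorem IsSolR.sub_le_of_nonneg {g a w v : ℝ → ℝ} {lam mu G s t : ℝ}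
    (hg : ContinuousOn g (Ici 0)) (ha : ∀ x y, IntervalIntegrable a volume x y)
    (hlam : 0 ≤ lam) (hst : s ≤ t)
    (hpos : ∀ᵐ x : ℝ ∂volume, x ∈ Icc s t → 0 ≤ a x)
    (hsol : IsSolR (fun t => lam * max (a t) 0 - mu * max (-a t) 0) g w v)
    (hw0 : ∀ t, 0 ≤ w t) (hG : ∀ x, g (w x) ≤ G) :
    v s - lam * G * ∫ x in s..t, max (a x) 0 ≤ v t := by
  have hw : Continuous w := continuous_iff_continuousAt.2 fun t => (hsol.1 t).continuousAt
  have hap := intervalIntegrable_max_zero ha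
  have han := intervalIntegrable_max_zero (b := fun x => -a x) fun x y => (ha x y).neg
  have hq := fun x y => ((hap x y).const_mul lam).sub ((han x y).const_mul mu)
  have hint : ∫ x in s..t, (lam * max (a x) 0 - mu * max (-a x) 0) * g (w x) ≤
      ∫ x in s..t, lam * G * max (a x) 0 := by
    refine intervalIntegral.integral_mono_ae_restrict hst
      (intervalIntegrable_weight_mul_comp hg hq hw hw0 s t) ((hap s t).const_mul _) ?_
    refine (ae_restrict_iff' measurableSet_Icc).2 ?_
    filter_upwards [hpos] with x hx hxm
    have h2 : max (-a x) 0 = 0 := max_eq_right (neg_nonpos.2 (hx hxm))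
    have h3 := mul_le_mul_of_nonneg_left (hG x) (mul_nonneg hlam (le_max_right (a x) 0))
    simp only [h2]
    linarith
  rw [intervalIntegral.integral_const_mul] at hint
  have := hsol.2 s t
  linarith

/-- Mean value theorem for a solution and its derivative. -/
theorem IsSolR.exists_mul_eq_sub {q g w v : ℝ → ℝ} (hsol : IsSolR q g w v) {s t : ℝ}
    (hst : s < t) : ∃ c ∈ Ioo s t, v c * (t - s) = w t - w s := by
  obtain ⟨c, hc, h⟩ := exists_hasDerivAt_eq_slope w v hst
    (fun x _ => (hsol.1 x).continuousAt.continuousWithinAt) fun x _ => hsol.1 x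
  exact ⟨c, hc, by rw [h, div_mul_cancel₀ _ (sub_pos.2 hst).ne']⟩

/-- If a positivity interval of the weight is followed by a negativity interval, then for large
`mu` bounded non-negative solutions are small at the common endpoint. -/
theorem exists_forall_lt_at_junction {g a : ℝ → ℝ} {σ τ σ' lam R ε : ℝ}
    (hg : ContinuousOn g (Ici 0)) (hg0 : ∀ s, 0 ≤ s → 0 ≤ g s)
    (hg_pos : ∀ s : ℝ, 0 < s → 0 < g s)
    (ha : ∀ x y, IntervalIntegrable a volume x y)
    (hστ : σ < τ) (hτσ : τ < σ')
    (hpos : ∀ᵐ x : ℝ ∂volume, x ∈ Icc σ τ → 0 ≤ a x)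
    (hneg : ∀ᵐ x : ℝ ∂volume, x ∈ Icc τ σ' → a x ≤ 0)
    (hnz : ∀ t, τ < t → t ≤ σ' → 0 < ∫ s in τ..t, max (-a s) 0)
    (hlam : 0 < lam) (hε : 0 < ε) (hεR : ε ≤ R) :
    ∃ M : ℝ, 0 < M ∧ ∀ mu, M < mu → ∀ w v : ℝ → ℝ,
      IsSolR (fun t => lam * max (a t) 0 - mu * max (-a t) 0) g w v →
      (∀ t, 0 ≤ w t) → (∀ t, w t ≤ R) → w τ < ε := by
  have hR : 0 < R := hε.trans_le hεR
  obtain ⟨x₀, hx₀, hmax⟩ := (isCompact_Icc (a := (0 : ℝ)) (b := R)).exists_isMaxOn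
    (nonempty_Icc.2 hR.le) (hg.mono Icc_subset_Ici_self)
  obtain ⟨x₁, hx₁, hmin⟩ := (isCompact_Icc (a := ε / 2) (b := R)).exists_isMinOn
    (nonempty_Icc.2 (by linarith)) (hg.mono fun x hx => (half_pos hε).le.trans hx.1)
  have hγ : 0 < g x₁ := hg_pos _ ((half_pos hε).trans_le hx₁.1)
  have hG : 0 < g x₀ := (hg_pos R hR).trans_le (hmax (right_mem_Icc.2 hR.le))
  set A := ∫ x in σ..τ, max (a x) 0 with hA
  have hA0 : 0 ≤ A := intervalIntegral.integral_nonneg hστ.le fun x _ => le_max_right _ _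
  set K := R / (τ - σ) + lam * g x₀ * A with hK
  have hK0 : 0 < K := by
    have := div_pos hR (sub_pos.2 hστ)
    positivity
  set δ := min (ε / (2 * K)) ((σ' - τ) / 2) with hδ
  have hδ0 : 0 < δ := lt_min (by positivity) (by linarith)
  have hδ1 : K * δ ≤ ε / 2 := by
    calc K * δ ≤ K * (ε / (2 * K)) := by gcongr; exact min_le_left _ _
      _ = ε / 2 := by field_simp
  have hδ2 : δ ≤ (σ' - τ) / 2 := min_le_right _ _
  set c := ∫ s in τ..(τ + δ), max (-a s) 0 with hc
  have hc0 : 0 < c := hnz _ (by linarith) (by linarith)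
  have hL : 0 < σ' - τ := sub_pos.2 hτσ
  refine ⟨(K + 2 * R / (σ' - τ)) / (g x₁ * c), by positivity, fun mu hmu w v hsol hw0 hwR => ?_⟩
  have hmu0 : 0 < mu := lt_trans (by positivity) hmu
  by_contra! hwτ
  have hvτ : -K ≤ v τ := by
    obtain ⟨d, hd, hd'⟩ := hsol.exists_mul_eq_sub hστ
    have h1 : -(R / (τ - σ)) ≤ v d := by
      rw [← neg_div, div_le_iff₀ (sub_pos.2 hστ)]
      linarith [hw0 τ, hwR σ]
    have h2 := hsol.sub_le_of_nonneg (G := g x₀) hg ha hlam.le hd.2.le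
      (hpos.mono fun x hx hxm => hx ⟨hd.1.le.trans hxm.1, hxm.2⟩) hw0
      fun x => hmax ⟨hw0 x, hwR x⟩
    have h3 : ∫ x in d..τ, max (a x) 0 ≤ A :=
      intervalIntegral.integral_mono_interval hd.1.le hd.2.le le_rfl
        (Eventually.of_forall fun x => le_max_right _ _) (intervalIntegrable_max_zero ha σ τ)
    have h4 := mul_le_mul_of_nonneg_left h3 (mul_pos hlam hG).le
    linarith
  have hmono : ∀ s t, τ ≤ s → s ≤ t → t ≤ σ' → v s ≤ v t := fun s t h1 h2 h3 => by
    have := hsol.add_le_of_nonpos (γ := 0) hg ha hmu0.le h2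
      (hneg.mono fun x hx hxm => hx ⟨h1.trans hxm.1, hxm.2.trans h3⟩) hw0
      fun x _ => hg0 _ (hw0 x)
    simpa using this
  have hlow : ∀ x ∈ Icc τ (τ + δ), ε / 2 ≤ w x := fun x hx => by
    rcases hx.1.eq_or_lt with rfl | h
    · linarith
    · obtain ⟨d, hd, hd'⟩ := hsol.exists_mul_eq_sub h
      have h1 : -K ≤ v d := hvτ.trans
        (hmono τ d le_rfl hd.1.le (by linarith [hd.2, hx.2]))
      have h2 := mul_le_mul_of_nonneg_right h1 (sub_pos.2 h).le
      have h3 : K * (x - τ) ≤ K * δ := by gcongr; linarith [hx.2]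
      linarith
  have hvδ := hsol.add_le_of_nonpos (γ := g x₁) hg ha hmu0.le
    (show τ ≤ τ + δ by linarith)
    (hneg.mono fun x hx hxm => hx ⟨hxm.1, by linarith [hxm.2]⟩) hw0
    fun x hx => hmin ⟨hlow x hx, hwR x⟩
  rw [div_lt_iff₀ (by positivity)] at hmu
  obtain ⟨d, hd, hd'⟩ := hsol.exists_mul_eq_sub (show τ + δ < σ' by linarith)
  have h1 := hmono (τ + δ) d (by linarith) hd.1.le hd.2.le
  have h2 : 2 * R / (σ' - τ) < v d := by linarith
  have h3 : R < v d * (σ' - (τ + δ)) := by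
    calc R = 2 * R / (σ' - τ) * ((σ' - τ) / 2) := by field_simp
      _ < v d * ((σ' - τ) / 2) := by gcongr
      _ ≤ v d * (σ' - (τ + δ)) := by
        have : 0 < v d := lt_trans (by positivity) h2
        gcongr
        linarith
  linarith [hw0 (τ + δ), hwR σ']

/-- Time reversal of a solution. -/
theorem IsSolR.comp_neg {q g w v : ℝ → ℝ} (hsol : IsSolR q g w v) :
    IsSolR (fun t => q (-t)) g (fun t => w (-t)) fun t => -v (-t) := by
  refine ⟨fun t => ?_, fun t₀ t => ?_⟩
  · have h := (hsol.1 (-t)).comp t (hasDerivAt_neg t)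
    rwa [mul_neg_one] at h
  · rw [intervalIntegral.integral_comp_neg fun s => q s * g (w s)]
    linarith [hsol.2 (-t) (-t₀)]

/-- Translation of a solution by a period of the coefficient. -/
theorem IsSolR.comp_add_period {q g w v : ℝ → ℝ} {c : ℝ} (hsol : IsSolR q g w v)
    (hq : Function.Periodic q c) :
    IsSolR q g (fun t => w (t + c)) fun t => v (t + c) := by
  refine ⟨fun t => (hsol.1 (t + c)).comp_add_const t c, fun t₀ t => ?_⟩
  have h := intervalIntegral.integral_comp_add_right (a := t₀) (b := t)
    (fun s => q s * g (w s)) c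
  simp only [hq _] at h
  rw [h]
  exact hsol.2 _ _

/-- If a negativity interval of the weight is followed by a positivity interval, then for large
`mu` bounded non-negative solutions are small at the common endpoint. -/
theorem exists_forall_lt_at_junction_right {g a : ℝ → ℝ} {τ σ' τ' lam R ε : ℝ}
    (hg : ContinuousOn g (Ici 0)) (hg0 : ∀ s, 0 ≤ s → 0 ≤ g s)
    (hg_pos : ∀ s : ℝ, 0 < s → 0 < g s)
    (ha : ∀ x y, IntervalIntegrable a volume x y)
    (hτσ : τ < σ') (hστ : σ' < τ')
    (hneg : ∀ᵐ x : ℝ ∂volume, x ∈ Icc τ σ' → a x ≤ 0)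
    (hpos : ∀ᵐ x : ℝ ∂volume, x ∈ Icc σ' τ' → 0 ≤ a x)
    (hnz : ∀ t, τ ≤ t → t < σ' → 0 < ∫ s in t..σ', max (-a s) 0)
    (hlam : 0 < lam) (hε : 0 < ε) (hεR : ε ≤ R) :
    ∃ M : ℝ, 0 < M ∧ ∀ mu, M < mu → ∀ w v : ℝ → ℝ,
      IsSolR (fun t => lam * max (a t) 0 - mu * max (-a t) 0) g w v →
      (∀ t, 0 ≤ w t) → (∀ t, w t ≤ R) → w σ' < ε := by
  have hqmp := (Measure.measurePreserving_neg (volume : Measure ℝ)).quasiMeasurePreserving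
  obtain ⟨M, hM, h⟩ := exists_forall_lt_at_junction (a := fun t => a (-t)) (σ := -τ')
    (τ := -σ') (σ' := -τ) hg hg0 hg_pos
    (fun x y => by simpa using (IntervalIntegrable.iff_comp_neg (by simp)).1 (ha (-x) (-y)))
    (neg_lt_neg hστ) (neg_lt_neg hτσ)
    ((hqmp.ae hpos).mono fun x hx hxm => hx ⟨le_neg.1 hxm.2, neg_le.1 hxm.1⟩)
    ((hqmp.ae hneg).mono fun x hx hxm => hx ⟨le_neg.1 hxm.2, neg_le.1 hxm.1⟩)
    (fun t h1 h2 => by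
      rw [intervalIntegral.integral_comp_neg fun s => max (-a s) 0, neg_neg]
      exact hnz _ (le_neg.1 h2) (neg_lt.1 h1)) hlam hε hεR
  refine ⟨M, hM, fun mu hmu w v hsol hw0 hwR => ?_⟩
  simpa using h mu hmu _ _ hsol.comp_neg (fun t => hw0 _) fun t => hwR _

/-- A non-negative solution is convex where the weight is non-positive. -/
theorem IsSolR.convexOn_of_nonpos {g a w v : ℝ → ℝ} {lam mu x y : ℝ}
    (hg : ContinuousOn g (Ici 0)) (hg0 : ∀ s, 0 ≤ s → 0 ≤ g s)
    (ha : ∀ x y, IntervalIntegrable a volume x y) (hmu : 0 ≤ mu)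
    (hneg : ∀ᵐ t : ℝ ∂volume, t ∈ Icc x y → a t ≤ 0)
    (hsol : IsSolR (fun t => lam * max (a t) 0 - mu * max (-a t) 0) g w v)
    (hw0 : ∀ t, 0 ≤ w t) : ConvexOn ℝ (Icc x y) w := by
  have hd : deriv w = v := funext fun t => (hsol.1 t).deriv
  refine MonotoneOn.convexOn_of_deriv (convex_Icc x y)
    (fun t _ => (hsol.1 t).continuousAt.continuousWithinAt)
    (fun t _ => (hsol.1 t).differentiableAt.differentiableWithinAt) ?_
  rw [hd]
  intro s hs t ht hst
  have hs' := interior_subset hs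
  have ht' := interior_subset ht
  have := hsol.add_le_of_nonpos (γ := 0) hg ha hmu hst
    (hneg.mono fun z hz hzm => hz ⟨hs'.1.trans hzm.1, hzm.2.trans ht'.2⟩) hw0
    fun z _ => hg0 _ (hw0 z)
  simpa using this

theorem stmt_10 (g a : ℝ → ℝ) (T : ℝ) (m : ℕ) (σ τ : ℕ → ℝ)
    (hg_cont : ContinuousOn g (Ici 0)) (hg_zero : g 0 = 0)
    (hg_pos : ∀ s : ℝ, 0 < s → 0 < g s)
    (hg0 : Tendsto (fun s => g s / s) (nhdsWithin 0 (Ioi 0)) (nhds 0))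
    (hginf : Tendsto (fun s => g s / s) atTop (nhds 0))
    (hm : 1 ≤ m)
    (hστ : ∀ i, 1 ≤ i → i ≤ m → σ i < τ i)
    (hτσ : ∀ i, 1 ≤ i → i ≤ m → τ i < σ (i + 1))
    (hσT : σ (m + 1) - σ 1 = T)
    (ha_per : ∀ t, a (t + T) = a t)
    (ha_loc : LocallyIntegrable a)
    (ha_pos : ∀ i, 1 ≤ i → i ≤ m →
      (∀ᵐ t : ℝ ∂volume, t ∈ Icc (σ i) (τ i) → 0 ≤ a t) ∧
        0 < ∫ t in (σ i)..(τ i), a t)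
    (ha_neg : ∀ i, 1 ≤ i → i ≤ m →
      (∀ᵐ t : ℝ ∂volume, t ∈ Icc (τ i) (σ (i + 1)) → a t ≤ 0) ∧
        (∫ t in (τ i)..(σ (i + 1)), a t) < 0)
    -- `a` is not a.e. zero near the endpoints of the negativity intervals:
    (ha_nz_left : ∀ i, 1 ≤ i → i ≤ m → ∀ t : ℝ, τ i < t → t ≤ σ (i + 1) →
      0 < ∫ s in (τ i)..t, max (-a s) 0)
    (ha_nz_right : ∀ i, 1 ≤ i → i ≤ m → ∀ t : ℝ, τ i ≤ t → t < σ (i + 1) →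
      0 < ∫ s in t..(σ (i + 1)), max (-a s) 0)
    (lam r R : ℝ) (hlam : 0 < lam) (hr : 0 < r) (hrR : r < R) :
    ∀ ε : ℝ, 0 < ε → ε ≤ r → ∃ muStar : ℝ, 0 < muStar ∧
      ∀ mu : ℝ, muStar < mu →
        ∀ w vw : ℝ → ℝ,
          IsSolR (fun t => lam * max (a t) 0 - mu * max (-a t) 0) g w vw →
          (∀ t, 0 ≤ w t) → (∀ t, w t ≤ R) →
          ∀ i, 1 ≤ i → i ≤ m → ∀ ℓ : ℤ,
            sSup (w '' Icc (τ i + ℓ * T) (σ (i + 1) + ℓ * T)) < ε := by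
  intro ε hε hεr
  have hεR : ε ≤ R := hεr.trans hrR.le
  have ha : ∀ x y, IntervalIntegrable a volume x y := fun x y =>
    (ha_loc.integrableOn_isCompact isCompact_uIcc).intervalIntegrable
  have hg0' : ∀ s, 0 ≤ s → 0 ≤ g s := fun s hs => by
    rcases hs.eq_or_lt with rfl | h
    · exact hg_zero.ge
    · exact (hg_pos s h).le
  have hnext : ∀ i, 1 ≤ i → i ≤ m → ∃ τ', σ (i + 1) < τ' ∧
      ∀ᵐ t : ℝ ∂volume, t ∈ Icc (σ (i + 1)) τ' → 0 ≤ a t := by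
    intro i hi him
    rcases him.eq_or_lt with rfl | h
    · refine ⟨τ 1 + T, by linarith [hστ 1 le_rfl hm], ?_⟩
      have hqmp := (measurePreserving_sub_right (volume : Measure ℝ) T).quasiMeasurePreserving
      filter_upwards [hqmp.ae (ha_pos 1 le_rfl hm).1] with t ht htm
      have := ht ⟨by linarith [htm.1], by linarith [htm.2]⟩
      rwa [← ha_per, sub_add_cancel] at this
    · exact ⟨τ (i + 1), hστ _ (by omega) h, (ha_pos (i + 1) (by omega) h).1⟩
  have hsingle : ∀ i, ∃ M : ℝ, 0 < M ∧ (1 ≤ i → i ≤ m → ∀ mu, M < mu → ∀ w v : ℝ → ℝ,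
      IsSolR (fun t => lam * max (a t) 0 - mu * max (-a t) 0) g w v →
      (∀ t, 0 ≤ w t) → (∀ t, w t ≤ R) → w (τ i) < ε ∧ w (σ (i + 1)) < ε) := by
    intro i
    by_cases hi : 1 ≤ i ∧ i ≤ m
    · obtain ⟨h1, h2⟩ := hi
      obtain ⟨τ', hτ', hpos'⟩ := hnext i h1 h2
      obtain ⟨M₁, hM₁, hl⟩ := exists_forall_lt_at_junction hg_cont hg0' hg_pos ha
        (hστ i h1 h2) (hτσ i h1 h2) (ha_pos i h1 h2).1 (ha_neg i h1 h2).1 (ha_nz_left i h1 h2)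
        hlam hε hεR
      obtain ⟨M₂, hM₂, hr'⟩ := exists_forall_lt_at_junction_right hg_cont hg0' hg_pos ha
        (hτσ i h1 h2) hτ' (ha_neg i h1 h2).1 hpos' (ha_nz_right i h1 h2) hlam hε hεR
      exact ⟨max M₁ M₂, lt_max_of_lt_left hM₁, fun _ _ mu hmu w v hsol hw0 hwR =>
        ⟨hl mu ((le_max_left _ _).trans_lt hmu) w v hsol hw0 hwR,
          hr' mu ((le_max_right _ _).trans_lt hmu) w v hsol hw0 hwR⟩⟩
    · exact ⟨1, one_pos, fun h1 h2 => absurd ⟨h1, h2⟩ hi⟩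
  choose M hM0 hM using hsingle
  have hMsum : ∀ i, i ≤ m → M i ≤ ∑ j ∈ Finset.range (m + 1), M j := fun i hi =>
    Finset.single_le_sum (fun j _ => (hM0 j).le) (Finset.mem_range.2 (by omega))
  refine ⟨∑ j ∈ Finset.range (m + 1), M j, (hM0 m).trans_le (hMsum m le_rfl), ?_⟩
  intro mu hmu w vw hsol hw0 hwR i h1 h2 ℓ
  have hmui : M i < mu := (hMsum i h2).trans_lt hmu
  have hper : Function.Periodic (fun t => lam * max (a t) 0 - mu * max (-a t) 0) (ℓ * T) :=
    Function.Periodic.int_mul (fun t => by simp only [ha_per]) ℓ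
  have hshift := hsol.comp_add_period hper
  obtain ⟨hl, hr'⟩ := hM i h1 h2 mu hmui _ _ hshift (fun t => hw0 _) fun t => hwR _
  have hconv := hshift.convexOn_of_nonpos hg_cont hg0' ha ((hM0 i).trans hmui).le
    (ha_neg i h1 h2).1 fun t => hw0 _
  have hle := (hτσ i h1 h2).le
  refine (csSup_le ((nonempty_Icc.2 (by linarith)).image w) ?_).trans_lt (max_lt hl hr')
  rintro _ ⟨t, ht, rfl⟩
  have := hconv.le_max_of_mem_Icc (left_mem_Icc.2 hle) (right_mem_Icc.2 hle)
    (z := t - ℓ * T) ⟨by linarith [ht.1], by linarith [ht.2]⟩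
  simpa using this
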